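/- For the group G₃ with distinguished element β: the automorphism τ of A(G₃, β) satisfies τ² − τ + id = 0, so that A(G₃, β) is a module over Λ = ℤ[t]/(t² − t + 1) with t acting as τ; this Λ-module is free of rank 3, with basis the classes of αβ⁻¹, γβ⁻¹ and γ̄β⁻¹. (This is the Alexander module of any plane sextic of weight nine.) -/

import Mathlib

namespace Sextics

abbrev F5 := FreeGroup (Fin 5)

def fa : F5 := FreeGroup.of 0
def fa' : F5 := FreeGroup.of 1
def fb : F5 := FreeGroup.of 2
def fc : F5 := FreeGroup.of 3
def fc' : F5 := FreeGroup.of 4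

/-- Relators of the group `G̃`: the braid relations `αβα = βαβ`, `ᾱβᾱ = βᾱβ`,
`γβγ = βγβ`, `γ̄βγ̄ = βγ̄β` and the relation at infinity `βγαβγ̄ᾱ = 1`. -/
def relsT : Set F5 :=
  {fa * fb * fa * (fb * fa * fb)⁻¹, fa' * fb * fa' * (fb * fa' * fb)⁻¹,
   fc * fb * fc * (fb * fc * fb)⁻¹, fc' * fb * fc' * (fb * fc' * fb)⁻¹,
   fb * fc * fa * fb * fc' * fa'}

abbrev Gt := PresentedGroup relsT

def at' : Gt := PresentedGroup.of 0
def abt : Gt := PresentedGroup.of 1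
def bt : Gt := PresentedGroup.of 2
def ct : Gt := PresentedGroup.of 3
def cbt : Gt := PresentedGroup.of 4

/-- Relators of `G₃`: those of `G̃` together with `γ̄αγ̄ = αγ̄α`, `γᾱγ = ᾱγᾱ`,
`γγ̄γ = γ̄γγ̄`, `γ̄⁻¹αγ̄ = γ⁻¹ᾱγ` and `β(α⁻¹γ⁻¹γ̄ᾱ) = (α⁻¹γ⁻¹γ̄ᾱ)β`. -/
def rels3 : Set F5 :=
  relsT ∪
    {fc' * fa * fc' * (fa * fc' * fa)⁻¹, fc * fa' * fc * (fa' * fc * fa')⁻¹,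
     fc * fc' * fc * (fc' * fc * fc')⁻¹,
     fc'⁻¹ * fa * fc' * (fc⁻¹ * fa' * fc)⁻¹,
     fb * (fa⁻¹ * fc⁻¹ * fc' * fa') * ((fa⁻¹ * fc⁻¹ * fc' * fa') * fb)⁻¹}

abbrev G3 := PresentedGroup rels3

def a3 : G3 := PresentedGroup.of 0
def a3' : G3 := PresentedGroup.of 1
def b3 : G3 := PresentedGroup.of 2
def c3 : G3 := PresentedGroup.of 3
def c3' : G3 := PresentedGroup.of 4

/-- Conjugation by `g` restricted to the commutator subgroup `G′`. -/
def conjSub {G : Type*} [Group G] (g : G) : ↥(commutator G) →* ↥(commutator G) where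
  toFun x := ⟨g * (x : G) * g⁻¹, Subgroup.Normal.conj_mem inferInstance (x : G) x.2 g⟩
  map_one' := by ext; simp
  map_mul' x y := by ext; simp [mul_assoc]

/-- The Alexander module `A(G, g) = G′/G″` of a group `G`, written additively.  (The
distinguished element `g` enters through the automorphism `tau g` below.) -/
abbrev AlexMod (G : Type*) [Group G] := Additive (Abelianization ↥(commutator G))

/-- The automorphism `τ` of `A(G, g)` induced by conjugation by `g`: `τ[x] = [g x g⁻¹]`. -/
def tau {G : Type*} [Group G] (g : G) : AlexMod G → AlexMod G :=
  fun x => Additive.ofMul (Abelianization.map (conjSub g) (Additive.toMul x))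

/-- The class in `A(G, g)` of an element of the derived subgroup. -/
def cls {G : Type*} [Group G] {w : G} (h : w ∈ commutator G) : AlexMod G :=
  Additive.ofMul (Abelianization.of (⟨w, h⟩ : ↥(commutator G)))

/-- The ring `Λ = ℤ[t]/(t² − t + 1)`. -/
abbrev Lam :=
  Polynomial ℤ ⧸ Ideal.span ({Polynomial.X ^ 2 - Polynomial.X + 1} : Set (Polynomial ℤ))

/-- The class `t ∈ Λ`. -/
noncomputable def tL : Lam := Ideal.Quotient.mk _ Polynomial.X

/-- The scalar multiplication of an explicitly given module structure. -/
def smulOf {R M : Type*} [Semiring R] [AddCommMonoid M] (inst : Module R M)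
    (r : R) (m : M) : M :=
  @SMul.smul R M inst.toDistribMulAction.toMulAction.toSMul r m

end Sextics

namespace Sextics

section Group

variable {G : Type*} [Group G]

/-- The action of `G` on its Alexander module, as a homomorphism to the endomorphism ring. -/
def tauHom : G →* AddMonoid.End (AlexMod G) where
  toFun g := MonoidHom.toAdditive (Abelianization.map (conjSub g))
  map_one' := by
    ext x
    induction x using Additive.rec with | ofMul x =>
    induction x using QuotientGroup.induction_on with | H x =>
    change Additive.ofMul (Abelianization.of (conjSub 1 x)) = Additive.ofMul (Abelianization.of x)
    congr 2
    ext
    simp [conjSub]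
  map_mul' g h := by
    ext x
    induction x using Additive.rec with | ofMul x =>
    induction x using QuotientGroup.induction_on with | H x =>
    change Additive.ofMul (Abelianization.of (conjSub (g * h) x)) =
      Additive.ofMul (Abelianization.of (conjSub g (conjSub h x)))
    congr 2
    ext
    simp [conjSub, mul_assoc]

theorem exists_cls (x : AlexMod G) : ∃ (w : G) (h : w ∈ commutator G), x = cls h := by
  induction x using Additive.rec with | ofMul x =>
  induction x using QuotientGroup.induction_on with | H x =>
  exact ⟨x, x.2, rfl⟩

theorem cls_mul {v w : G} (hv : v ∈ commutator G) (hw : w ∈ commutator G) :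
    cls (mul_mem hv hw) = cls hv + cls hw := rfl

theorem cls_one : cls (one_mem (commutator G)) = 0 := rfl

theorem cls_congr {v w : G} (hv : v ∈ commutator G) (hw : w ∈ commutator G) (h : v = w) :
    cls hv = cls hw := by
  subst h
  rfl

theorem conj_mem_commutator (g : G) {w : G} (hw : w ∈ commutator G) :
    g * w * g⁻¹ ∈ commutator G :=
  Subgroup.Normal.conj_mem inferInstance w hw g

theorem tauHom_cls (g : G) {w : G} (hw : w ∈ commutator G) :
    tauHom g (cls hw) = cls (conj_mem_commutator g hw) := rfl

theorem tauHom_eq_one {w : G} (hw : w ∈ commutator G) : tauHom w = 1 := by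
  ext x
  obtain ⟨v, hv, rfl⟩ := exists_cls x
  calc tauHom w (cls hv) = cls hw + cls hv + -cls hw := rfl
    _ = cls hv := by abel

theorem tauHom_eq_of_mul_inv_mem {g h : G} (hgh : g * h⁻¹ ∈ commutator G) :
    tauHom g = tauHom h := by
  have := tauHom_eq_one hgh
  rw [← inv_mul_cancel_right g h, map_mul, this, one_mul]

/-- Two elements satisfying the braid relation have the same class in the abelianization. -/
theorem mul_inv_mem_commutator_of_braid {g h : G} (hgh : g * h * g = h * g * h) :
    g * h⁻¹ ∈ commutator G := by
  rw [← Abelianization.ker_of, MonoidHom.mem_ker, map_mul, map_inv, mul_inv_eq_one]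
  have := congrArg Abelianization.of hgh
  simp only [map_mul] at this
  rw [mul_comm (Abelianization.of h)] at this
  exact mul_left_cancel this

theorem tau_quadratic_of_braid {g h : G} (hgh : g * h * g = h * g * h)
    (hm : g * h⁻¹ ∈ commutator G) :
    tauHom h (tauHom h (cls hm)) - tauHom h (cls hm) + cls hm = 0 := by
  rw [add_comm, ← add_sub_assoc, sub_eq_zero]
  simp only [tauHom_cls, ← cls_mul]
  apply cls_congr
  calc g * h⁻¹ * (h * (h * (g * h⁻¹) * h⁻¹) * h⁻¹) = g * h * g * (h⁻¹ * h⁻¹ * h⁻¹) := by group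
    _ = h * (g * h⁻¹) * h⁻¹ := by rw [hgh]; group

/-- If `G` is generated by elements of `S` that are all congruent to `b` modulo `G′`, then
the Alexander module is generated, under the action of `b`, by the classes of `s b⁻¹`. -/
theorem eq_top_of_generators {S : Set G} {b : G} (hS : Subgroup.closure S = ⊤)
    (hm : ∀ s ∈ S, s * b⁻¹ ∈ commutator G) (Q : AddSubgroup (AlexMod G))
    (hQ : ∀ s (hs : s ∈ S), cls (hm s hs) ∈ Q) (hb : ∀ x ∈ Q, tauHom b x ∈ Q)
    (hb' : ∀ x ∈ Q, tauHom b⁻¹ x ∈ Q) : Q = ⊤ := by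
  have stable : ∀ g : G, ∀ x ∈ Q, tauHom g x ∈ Q := by
    intro g
    have hg : g ∈ Subgroup.closure S := hS ▸ Subgroup.mem_top g
    induction hg using Subgroup.closure_induction_left with
    | one => simp
    | mul_left s hs y _ ih =>
      intro x hx
      rw [map_mul, tauHom_eq_of_mul_inv_mem (hm s hs)]
      exact hb _ (ih x hx)
    | inv_mul_cancel s hs y _ ih =>
      intro x hx
      have hinv : s⁻¹ * b⁻¹⁻¹ ∈ commutator G := by
        rw [← mul_inv_rev]
        exact inv_mem ((commutator G).normal_of_characteristic.mem_comm (hm s hs))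
      rw [map_mul, tauHom_eq_of_mul_inv_mem hinv]
      exact hb' _ (ih x hx)
  let K : Subgroup G :=
    { carrier := {w | ∃ h : w ∈ commutator G, cls h ∈ Q}
      one_mem' := ⟨one_mem _, Q.zero_mem⟩
      mul_mem' := fun ⟨h, hx⟩ ⟨k, hy⟩ => ⟨mul_mem h k, Q.add_mem hx hy⟩
      inv_mem' := fun ⟨h, hx⟩ => ⟨inv_mem h, Q.neg_mem hx⟩ }
  have : K.Normal := ⟨fun w ⟨h, hx⟩ g => ⟨conj_mem_commutator g h, stable g _ hx⟩⟩
  have hle : commutator G ≤ K := by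
    have hcyc : ∀ g : G, (g : G ⧸ K) ∈ Subgroup.zpowers (b : G ⧸ K) := by
      intro g
      have hg : g ∈ Subgroup.closure S := hS ▸ Subgroup.mem_top g
      induction hg using Subgroup.closure_induction with
      | mem s hs =>
        have : (s : G ⧸ K) = b := by
          rw [← mul_inv_eq_one, ← QuotientGroup.mk_inv, ← QuotientGroup.mk_mul,
            QuotientGroup.eq_one_iff]
          exact ⟨hm s hs, hQ s hs⟩
        rw [this]
        exact Subgroup.mem_zpowers _
      | one => exact one_mem _
      | mul _ _ _ _ h₁ h₂ => exact mul_mem h₁ h₂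
      | inv _ _ h => exact inv_mem h
    rw [commutator_def, Subgroup.commutator_le]
    intro g _ h _
    rw [← QuotientGroup.eq_one_iff]
    obtain ⟨m, hm⟩ := hcyc g
    obtain ⟨n, hn⟩ := hcyc h
    rw [commutatorElement_def]
    simp only [QuotientGroup.mk_mul, QuotientGroup.mk_inv, ← hm, ← hn]
    group
  rw [eq_top_iff]
  intro x _
  obtain ⟨w, hw, rfl⟩ := exists_cls x
  exact (hle hw).2

end Group

section Lambda

theorem tL_sq : tL ^ 2 - tL + 1 = 0 :=
  Ideal.Quotient.eq_zero_iff_mem.2 (Ideal.subset_span rfl)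

/-- The class `t ∈ Λ` as a unit, with inverse `1 - t`. -/
noncomputable def tUnit : Lamˣ where
  val := tL
  inv := 1 - tL
  val_inv := by linear_combination -tL_sq
  inv_val := by linear_combination -tL_sq

variable {A : Type*} [AddCommGroup A]

/-- The homomorphism from `Λ` to an endomorphism ring sending `t` to a root of
`t² - t + 1`. -/
noncomputable def lamLift (T : AddMonoid.End A) (hT : T ^ 2 - T + 1 = 0) :
    Lam →+* AddMonoid.End A :=
  Ideal.Quotient.lift _ (Polynomial.aeval T : Polynomial ℤ →ₐ[ℤ] AddMonoid.End A).toRingHom (by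
    intro p hp
    obtain ⟨q, rfl⟩ := Ideal.mem_span_singleton.1 hp
    simp [hT])

theorem lamLift_tL (T : AddMonoid.End A) (hT : T ^ 2 - T + 1 = 0) : lamLift T hT tL = T := by
  simp [lamLift, tL]

/-- The `Λ`-module structure in which `t` acts as a root of `t² - t + 1`. -/
noncomputable abbrev lamModule (T : AddMonoid.End A) (hT : T ^ 2 - T + 1 = 0) : Module Lam A :=
  Module.compHom A (lamLift T hT)

theorem map_lamLift {M : Type*} [AddCommGroup M] [Module Lam M] (T : AddMonoid.End A)
    (hT : T ^ 2 - T + 1 = 0) (f : A →+ M) (hf : ∀ x, f (T x) = tL • f x) (r : Lam) (x : A) :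
    f (lamLift T hT r x) = r • f x := by
  obtain ⟨p, rfl⟩ := Ideal.Quotient.mk_surjective r
  induction p using Polynomial.induction_on generalizing x with
  | C n => simp [lamLift, Int.cast_smul_eq_zsmul]
  | add p q hp hq =>
    rw [map_add, map_add, add_smul, ← hp, ← hq, ← f.map_add]
    rfl
  | monomial n c h =>
    rw [show Polynomial.C c * Polynomial.X ^ (n + 1) =
      Polynomial.C c * Polynomial.X ^ n * Polynomial.X by ring, map_mul, map_mul,
      AddMonoid.End.coe_mul, Function.comp_apply, h]
    change _ • f (lamLift T hT tL x) = (_ * tL) • f x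
    rw [lamLift_tL, hf, mul_smul]

end Lambda

section Affine

/-- The action of `Λˣ` on a `Λ`-module, written multiplicatively. -/
noncomputable def unitsAct (M : Type*) [AddCommGroup M] [Module Lam M] :
    Lamˣ →* MulAut (Multiplicative M) where
  toFun u := AddEquiv.toMultiplicative (DistribMulAction.toAddEquiv M u)
  map_one' := by ext; simp
  map_mul' u v := by ext x; simp [mul_smul]

/-- The group of affine transformations `x ↦ u x + m` of a `Λ`-module. -/
abbrev Aff (M : Type*) [AddCommGroup M] [Module Lam M] :=
  Multiplicative M ⋊[unitsAct M] Lamˣ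

variable {G M : Type*} [Group G] [AddCommGroup M] [Module Lam M]

theorem affine_right_eq_one (f : G →* Aff M) {w : G} (hw : w ∈ commutator G) :
    (f w).right = 1 := by
  have := Abelianization.commutator_subset_ker (A := Lamˣ)
    ((SemidirectProduct.rightHom : Aff M →* Lamˣ).comp f) hw
  simpa using this

/-- A representation of `G` by affine transformations of `M` sends `G′` to translations, hence
induces a homomorphism from the Alexander module to `M`. -/
noncomputable def alexMap (f : G →* Aff M) : AlexMod G →+ M :=
  MonoidHom.toAdditiveLeft (Abelianization.lift
    { toFun := fun w : ↥(commutator G) => (f w).left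
      map_one' := by simp
      map_mul' := fun v w => by simp [affine_right_eq_one f v.2] })

theorem alexMap_cls (f : G →* Aff M) {w : G} (hw : w ∈ commutator G) :
    alexMap f (cls hw) = (f w).left.toAdd := rfl

theorem alexMap_tauHom (f : G →* Aff M) {b : G} (hb : (f b).right = tUnit) (x : AlexMod G) :
    alexMap f (tauHom b x) = tL • alexMap f x := by
  obtain ⟨w, hw, rfl⟩ := exists_cls x
  rw [tauHom_cls, alexMap_cls, alexMap_cls]
  simp [affine_right_eq_one f hw, hb, unitsAct, tUnit, Units.smul_def]
  linear_combination (norm := module) tL_sq • (f b).left.toAdd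

/-- The affine transformation `x ↦ t x + m`. -/
noncomputable def affGen (m : M) : Aff M := ⟨.ofAdd m, tUnit⟩

theorem toAdd_left_affGen_mul (m : M) (x : Aff M) :
    (affGen m * x).left.toAdd = m + tL • x.left.toAdd := rfl

theorem toAdd_left_affGen_inv_mul (m : M) (x : Aff M) :
    ((affGen m)⁻¹ * x).left.toAdd = (1 - tL) • (x.left.toAdd - m) := by
  change (1 - tL) • (-m) + (1 - tL) • x.left.toAdd = _
  module

theorem toAdd_left_affGen (m : M) : (affGen m).left.toAdd = m := rfl

theorem right_affGen (m : M) : (affGen m).right = tUnit := rfl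

theorem tUnit_pow_six : tUnit ^ 6 = 1 := by
  ext
  change tL ^ 6 = 1
  have := tL_sq
  grind

theorem affGen_braid (x y : M) :
    affGen x * affGen y * affGen x = affGen y * affGen x * affGen y := by
  refine SemidirectProduct.ext (Multiplicative.toAdd.injective ?_) ?_
  · simp only [mul_assoc, toAdd_left_affGen_mul, toAdd_left_affGen]
    linear_combination (norm := module) tL_sq • (x - y)
  · simp only [SemidirectProduct.mul_right, right_affGen]

theorem affGen_relation_at_infinity (a c c' : M) :
    affGen 0 * affGen c * affGen a * affGen 0 * affGen c' * affGen (a + (1 - tL) • (c - c')) =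
      1 := by
  refine SemidirectProduct.ext (Multiplicative.toAdd.injective ?_) ?_
  · simp only [mul_assoc, toAdd_left_affGen_mul, toAdd_left_affGen, SemidirectProduct.one_left,
      toAdd_one]
    have := tL_sq
    match_scalars <;> grind
  · simp only [SemidirectProduct.mul_right, right_affGen, ← pow_succ, ← sq,
      SemidirectProduct.one_right]
    exact tUnit_pow_six

theorem affGen_conj (a c c' : M) :
    (affGen c')⁻¹ * affGen a * affGen c' =
      (affGen c)⁻¹ * affGen (a + (1 - tL) • (c - c')) * affGen c := by
  refine SemidirectProduct.ext (Multiplicative.toAdd.injective ?_) ?_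
  · simp only [mul_assoc, toAdd_left_affGen_mul, toAdd_left_affGen_inv_mul, toAdd_left_affGen]
    have := tL_sq
    match_scalars <;> grind
  · simp only [SemidirectProduct.mul_right, SemidirectProduct.inv_right, right_affGen]

theorem affGen_commute (a c c' : M) :
    affGen 0 * ((affGen a)⁻¹ * (affGen c)⁻¹ * affGen c' * affGen (a + (1 - tL) • (c - c'))) =
      (affGen a)⁻¹ * (affGen c)⁻¹ * affGen c' * affGen (a + (1 - tL) • (c - c')) * affGen 0 := by
  refine SemidirectProduct.ext (Multiplicative.toAdd.injective ?_) ?_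
  · simp only [mul_assoc, toAdd_left_affGen_mul, toAdd_left_affGen_inv_mul, toAdd_left_affGen]
    have := tL_sq
    match_scalars <;> grind
  · simp only [SemidirectProduct.mul_right, SemidirectProduct.inv_right, right_affGen]
    exact mul_comm tUnit _

end Affine

section G3

theorem braid_a_b : a3 * b3 * a3 = b3 * a3 * b3 :=
  PresentedGroup.mk_eq_mk_of_mul_inv_mem (x := fa * fb * fa) (y := fb * fa * fb)
    (by simp [rels3, relsT])

theorem braid_a'_b : a3' * b3 * a3' = b3 * a3' * b3 :=
  PresentedGroup.mk_eq_mk_of_mul_inv_mem (x := fa' * fb * fa') (y := fb * fa' * fb)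
    (by simp [rels3, relsT])

theorem braid_c_b : c3 * b3 * c3 = b3 * c3 * b3 :=
  PresentedGroup.mk_eq_mk_of_mul_inv_mem (x := fc * fb * fc) (y := fb * fc * fb)
    (by simp [rels3, relsT])

theorem braid_c'_b : c3' * b3 * c3' = b3 * c3' * b3 :=
  PresentedGroup.mk_eq_mk_of_mul_inv_mem (x := fc' * fb * fc') (y := fb * fc' * fb)
    (by simp [rels3, relsT])

theorem relation_at_infinity : b3 * c3 * a3 * b3 * c3' * a3' = 1 :=
  PresentedGroup.one_of_mem (x := fb * fc * fa * fb * fc' * fa') (by simp [rels3, relsT])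

theorem a3_mem : a3 * b3⁻¹ ∈ commutator G3 := mul_inv_mem_commutator_of_braid braid_a_b

theorem a3'_mem : a3' * b3⁻¹ ∈ commutator G3 := mul_inv_mem_commutator_of_braid braid_a'_b

theorem c3_mem : c3 * b3⁻¹ ∈ commutator G3 := mul_inv_mem_commutator_of_braid braid_c_b

theorem c3'_mem : c3' * b3⁻¹ ∈ commutator G3 := mul_inv_mem_commutator_of_braid braid_c'_b

/-- A subgroup of the Alexander module of `G₃` that is stable under `τ` and `τ⁻¹` and
contains the classes of `αβ⁻¹`, `ᾱβ⁻¹`, `γβ⁻¹` and `γ̄β⁻¹` is everything. -/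
theorem alexMod_G3_eq_top (Q : AddSubgroup (AlexMod G3)) (ha : cls a3_mem ∈ Q)
    (ha' : cls a3'_mem ∈ Q) (hc : cls c3_mem ∈ Q) (hc' : cls c3'_mem ∈ Q)
    (hb : ∀ x ∈ Q, tauHom b3 x ∈ Q) (hb' : ∀ x ∈ Q, tauHom b3⁻¹ x ∈ Q) : Q = ⊤ := by
  have hbm : b3 * b3⁻¹ ∈ commutator G3 := by
    rw [mul_inv_cancel]
    exact one_mem _
  have hm : ∀ s ∈ Set.range (PresentedGroup.of (rels := rels3)), s * b3⁻¹ ∈ commutator G3 := by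
    rintro _ ⟨i, rfl⟩
    fin_cases i
    exacts [a3_mem, a3'_mem, hbm, c3_mem, c3'_mem]
  refine eq_top_of_generators (PresentedGroup.closure_range_of rels3) hm Q ?_ hb hb'
  rintro _ ⟨i, rfl⟩
  fin_cases i
  · exact ha
  · exact ha'
  · have : cls hbm = 0 := (cls_congr hbm (one_mem _) (mul_inv_cancel b3)).trans cls_one
    exact this ▸ Q.zero_mem
  · exact hc
  · exact hc'

theorem tauHom_b3_quadratic : (tauHom b3 : AddMonoid.End (AlexMod G3)) ^ 2 - tauHom b3 + 1 = 0 := by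
  set P : AddMonoid.End (AlexMod G3) := tauHom b3 ^ 2 - tauHom b3 + 1 with hP
  have hPb : Commute P (tauHom b3) := by
    rw [hP]
    exact (((Commute.refl _).pow_left 2).sub_left (Commute.refl _)).add_left (Commute.one_left _)
  have hPb' : Commute P (tauHom b3⁻¹) := by
    have h₁ : (tauHom b3 * tauHom b3⁻¹ : AddMonoid.End (AlexMod G3)) = 1 := by
      rw [← map_mul, mul_inv_cancel, map_one]
    have h₂ : (tauHom b3⁻¹ * tauHom b3 : AddMonoid.End (AlexMod G3)) = 1 := by
      rw [← map_mul, inv_mul_cancel, map_one]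
    exact Commute.units_inv_right (u := ⟨_, _, h₁, h₂⟩) hPb
  have hstab : ∀ S : AddMonoid.End (AlexMod G3), Commute P S → ∀ x ∈ AddMonoidHom.ker P,
      S x ∈ AddMonoidHom.ker P := by
    intro S hS x hx
    replace hx : P x = 0 := hx
    exact (DFunLike.congr_fun hS.eq x).trans ((congrArg S hx).trans (map_zero S))
  have htop : AddMonoidHom.ker P = ⊤ := alexMod_G3_eq_top _
    (tau_quadratic_of_braid braid_a_b a3_mem) (tau_quadratic_of_braid braid_a'_b a3'_mem)
    (tau_quadratic_of_braid braid_c_b c3_mem) (tau_quadratic_of_braid braid_c'_b c3'_mem)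
    (hstab _ hPb) (hstab _ hPb')
  ext x
  exact AddMonoidHom.mem_ker.1 (htop ▸ AddSubgroup.mem_top x)

/-- The `Λ`-module structure on the Alexander module of `G₃`. -/
noncomputable abbrev moduleG3 : Module Lam (AlexMod G3) :=
  lamModule (tauHom b3) tauHom_b3_quadratic

attribute [local instance] moduleG3

theorem tL_smul (x : AlexMod G3) : tL • x = tauHom b3 x :=
  DFunLike.congr_fun (lamLift_tL (tauHom b3) tauHom_b3_quadratic) x

theorem tauHom_b3_inv (x : AlexMod G3) : tauHom b3⁻¹ x = (1 - tL) • x := by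
  have h : tauHom b3 (tauHom b3⁻¹ x) = x := by
    have := DFunLike.congr_fun (tauHom.map_mul b3 b3⁻¹) x
    rw [mul_inv_cancel, map_one] at this
    exact this.symm
  rw [← tL_smul] at h
  generalize tauHom b3⁻¹ x = y at h
  subst h
  linear_combination (norm := module) tL_sq • y

theorem cls_a3' :
    cls a3'_mem = cls a3_mem + (1 - tL) • (cls c3_mem - cls c3'_mem) := by
  set w : AlexMod G3 := tauHom b3 (cls c3_mem) + tauHom b3 (tauHom b3 (cls a3_mem)) +
      tauHom b3 (tauHom b3 (tauHom b3 (tauHom b3 (cls c3'_mem)))) +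
      tauHom b3 (tauHom b3 (tauHom b3 (tauHom b3 (tauHom b3 (cls a3'_mem))))) with hw
  have key : tauHom b3 w = w := by
    simp only [hw, tauHom_cls, ← cls_mul]
    apply cls_congr
    have : ∀ u : G3, u = b3⁻¹ ^ 6 → b3 * u * b3⁻¹ = u := by
      rintro _ rfl
      group
    apply this
    calc _ = (b3 * c3 * a3 * b3 * c3' * a3') * b3⁻¹ ^ 6 := by group
      _ = _ := by rw [relation_at_infinity, one_mul]
  simp only [← tL_smul, smul_smul] at hw key
  rw [hw] at key
  linear_combination (norm := skip) (1 - tL) • key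
  have := tL_sq
  match_scalars <;> grind

/-- The affine representation of `G₃` determined by three elements of a `Λ`-module. -/
noncomputable def affG3 {M : Type*} [AddCommGroup M] [Module Lam M] (a c c' : M) : G3 →* Aff M :=
  PresentedGroup.toGroup (rels := rels3)
    (f := ![affGen a, affGen (a + (1 - tL) • (c - c')), affGen 0, affGen c, affGen c']) (by
    set f := ![affGen a, affGen (a + (1 - tL) • (c - c')), affGen 0, affGen c, affGen c']
    have ha : FreeGroup.lift f fa = affGen a := FreeGroup.lift_apply_of
    have ha' : FreeGroup.lift f fa' = affGen (a + (1 - tL) • (c - c')) := FreeGroup.lift_apply_of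
    have hb : FreeGroup.lift f fb = affGen 0 := FreeGroup.lift_apply_of
    have hc : FreeGroup.lift f fc = affGen c := FreeGroup.lift_apply_of
    have hc' : FreeGroup.lift f fc' = affGen c' := FreeGroup.lift_apply_of
    intro r hr
    simp only [rels3, relsT, Set.mem_union, Set.mem_insert_iff, Set.mem_singleton_iff] at hr
    rcases hr with (rfl | rfl | rfl | rfl | rfl) | (rfl | rfl | rfl | rfl | rfl) <;>
      simp only [map_mul, map_inv, ha, ha', hb, hc, hc']
    case inl.inr.inr.inr.inr => exact affGen_relation_at_infinity a c c'
    all_goals rw [mul_inv_eq_one]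
    case inr.inr.inr.inr.inl => exact affGen_conj a c c'
    case inr.inr.inr.inr.inr => exact affGen_commute a c c'
    all_goals exact affGen_braid _ _)

theorem alexMap_affG3_cls {M : Type*} [AddCommGroup M] [Module Lam M] (a c c' x : M) {w : G3}
    (hw : w * b3⁻¹ ∈ commutator G3) (hx : affG3 a c c' w = affGen x) :
    alexMap (affG3 a c c') (cls hw) = x := by
  have hb : affG3 a c c' b3 = affGen 0 := PresentedGroup.toGroup.of _
  rw [alexMap_cls, map_mul, map_inv, hx, hb, toAdd_left_affGen_mul]
  change x + tL • (1 - tL) • (-0 : M) = x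
  simp

theorem span_eq_top :
    Submodule.span Lam {cls a3_mem, cls c3_mem, cls c3'_mem} = ⊤ := by
  set S := Submodule.span Lam {cls a3_mem, cls c3_mem, cls c3'_mem}
  have ha : cls a3_mem ∈ S := Submodule.subset_span (by simp)
  have hc : cls c3_mem ∈ S := Submodule.subset_span (by simp)
  have hc' : cls c3'_mem ∈ S := Submodule.subset_span (by simp)
  have ha' : cls a3'_mem ∈ S := by
    rw [cls_a3']
    exact S.add_mem ha (S.smul_mem _ (S.sub_mem hc hc'))
  have := alexMod_G3_eq_top S.toAddSubgroup ha ha' hc hc'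
    (fun x hx => tL_smul x ▸ S.smul_mem _ hx) (fun x hx => tauHom_b3_inv x ▸ S.smul_mem _ hx)
  exact Submodule.toAddSubgroup_injective this

end G3

end Sextics

open Sextics

/-- The Alexander module of the group `G₃`, with distinguished element `β`: the
automorphism `τ` satisfies `τ² − τ + id = 0`, making `A(G₃, β)` a module over
`Λ = ℤ[t]/(t² − t + 1)` with `t` acting as `τ`, and this module is free of rank `3` with
basis the classes of `αβ⁻¹`, `γβ⁻¹` and `γ̄β⁻¹`.  (This is the Alexander module of any
plane sextic of weight nine.) -/
theorem alexander_module_G3 :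
    (∀ x : AlexMod G3, tau b3 (tau b3 x) - tau b3 x + x = 0) ∧
    ∃ (h1 : a3 * b3⁻¹ ∈ commutator G3) (h2 : c3 * b3⁻¹ ∈ commutator G3)
      (h3 : c3' * b3⁻¹ ∈ commutator G3) (inst : Module Lam (AlexMod G3)),
      (∀ x : AlexMod G3, smulOf inst tL x = tau b3 x) ∧
      Function.Bijective (fun v : Fin 3 → Lam =>
        smulOf inst (v 0) (cls h1) + smulOf inst (v 1) (cls h2) +
          smulOf inst (v 2) (cls h3)) := by
  refine ⟨DFunLike.congr_fun ((congrArg (· - tauHom b3 + 1) (sq (tauHom b3))).symm.trans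
    tauHom_b3_quadratic), a3_mem, c3_mem, c3'_mem, moduleG3, tL_smul, ?_, ?_⟩
  · let e : Fin 3 → Fin 3 → Lam := fun i => Pi.single i 1
    let F : AlexMod G3 →+ (Fin 3 → Lam) := alexMap (affG3 (e 0) (e 1) (e 2))
    have hF : ∀ (r : Lam) (x : AlexMod G3), F (smulOf moduleG3 r x) = r • F x :=
      map_lamLift _ tauHom_b3_quadratic F (alexMap_tauHom _ (congrArg SemidirectProduct.right
        (PresentedGroup.toGroup.of (x := (2 : Fin 5)) _)))
    have h₀ : F (cls a3_mem) = e 0 := alexMap_affG3_cls _ _ _ _ _ (PresentedGroup.toGroup.of _)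
    have h₁ : F (cls c3_mem) = e 1 := alexMap_affG3_cls _ _ _ _ _ (PresentedGroup.toGroup.of _)
    have h₂ : F (cls c3'_mem) = e 2 := alexMap_affG3_cls _ _ _ _ _ (PresentedGroup.toGroup.of _)
    refine Function.LeftInverse.injective (g := F) fun v => ?_
    simp only [map_add, hF, h₀, h₁, h₂]
    ext i
    fin_cases i <;> simp [e]
  · intro x
    let := moduleG3
    have hx : x ∈ Submodule.span Lam {cls a3_mem, cls c3_mem, cls c3'_mem} :=
      span_eq_top ▸ Submodule.mem_top
    obtain ⟨p, q, r, h⟩ := Submodule.mem_span_triple.1 hx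
    exact ⟨![p, q, r], h⟩
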